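/- For any small category C, the category RelPsh(C) of relational presheaves over C is locally finitely presentable: it is cocomplete and has a small family of finitely presentable objects such that every object is a filtered colimit of objects from this family. -/

import Mathlib

open CategoryTheory

/-- A relational presheaf over a small category `C`. -/
structure RelPsh (C : Type) [SmallCategory C] : Type 1 where
  obj : C → Type
  rel : ∀ {c d : C}, (d ⟶ c) → obj c → obj d → Prop
  refl : ∀ {c : C} (x : obj c), rel (𝟙 c) x x
  trans : ∀ {c d e : C} {f : d ⟶ c} {g : e ⟶ d} {x : obj c} {y : obj d} {z : obj e},
    rel f x y → rel g y z → rel (g ≫ f) x z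

/-- A morphism of relational presheaves. -/
@[ext]
structure RelPshHom {C : Type} [SmallCategory C] (P Q : RelPsh C) where
  app : ∀ c, P.obj c → Q.obj c
  rel : ∀ {c d : C} (f : d ⟶ c) (x : P.obj c) (y : P.obj d),
    P.rel f x y → Q.rel f (app c x) (app d y)

instance {C : Type} [SmallCategory C] : Category (RelPsh C) where
  Hom := RelPshHom
  id P := { app := fun _ x => x, rel := fun _ _ _ h => h }
  comp α β := { app := fun c x => β.app c (α.app c x),
                rel := fun f x y h => β.rel f _ _ (α.rel f x y h) }

@[ext]
theorem RelPsh.hom_ext {C : Type} [SmallCategory C] {P Q : RelPsh C} {α β : P ⟶ Q}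
    (h : ∀ c (x : P.obj c), α.app c x = β.app c x) : α = β :=
  RelPshHom.ext (funext fun c => funext fun x => h c x)

open CategoryTheory.Limits

/-- An object `X` of a category is finitely presentable if `Hom(X, −)` preserves
filtered colimits. -/
def FinitelyPresentable (D : Type*) [Category D] (X : D) : Prop :=
  Nonempty (PreservesFilteredColimits (coyoneda.obj (Opposite.op X)))

namespace RelPsh

variable {C : Type} [SmallCategory C]

@[simp]
theorem id_app (P : RelPsh C) {c : C} (x : P.obj c) : RelPshHom.app (𝟙 P) c x = x := rfl

@[simp]
theorem comp_app {P Q R : RelPsh C} (α : P ⟶ Q) (β : Q ⟶ R) {c : C} (x : P.obj c) :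
    RelPshHom.app (α ≫ β) c x = β.app c (α.app c x) := rfl

/-- Evaluation of relational presheaves at an object. -/
def evaluation (c : C) : RelPsh C ⥤ Type where
  obj P := P.obj c
  map α := ↾(α.app c)

section Colimits

variable {J : Type} [SmallCategory J] (K : J ⥤ RelPsh C)

/-- The canonical map to the pointwise colimit. -/
noncomputable def toColimit (j : J) {c : C} (x : (K.obj j).obj c) :
    (colimit (K ⋙ evaluation c) : Type) :=
  colimit.ι (K ⋙ evaluation c) j x

variable {K}

theorem toColimit_surjective {c : C} (x : (colimit (K ⋙ evaluation c) : Type)) :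
    ∃ (j : J) (y : (K.obj j).obj c), toColimit K j y = x :=
  Types.jointly_surjective' x

theorem toColimit_map {j k : J} (u : j ⟶ k) {c : C} (x : (K.obj j).obj c) :
    toColimit K k ((K.map u).app c x) = toColimit K j x :=
  colimit.w_apply (K ⋙ evaluation c) u x

theorem toColimit_eq_iff [IsFiltered J] {i j : J} {c : C} {x : (K.obj i).obj c}
    {y : (K.obj j).obj c} :
    toColimit K i x = toColimit K j y ↔
      ∃ (k : J) (u : i ⟶ k) (v : j ⟶ k), (K.map u).app c x = (K.map v).app c y :=
  Types.FilteredColimit.colimit_eq_iff (F := K ⋙ evaluation c) (xi := x) (xj := y)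

variable (K)

/-- The relations on the pointwise colimit generated by those of the diagram. -/
inductive ColimitRel : ∀ {c d : C}, (d ⟶ c) → (colimit (K ⋙ evaluation c) : Type) →
    (colimit (K ⋙ evaluation d) : Type) → Prop
  | of (j : J) {c d : C} (f : d ⟶ c) (x : (K.obj j).obj c) (y : (K.obj j).obj d)
      (h : (K.obj j).rel f x y) : ColimitRel f (toColimit K j x) (toColimit K j y)
  | trans {c d e : C} {f : d ⟶ c} {g : e ⟶ d} {x : (colimit (K ⋙ evaluation c) : Type)}
      {y : (colimit (K ⋙ evaluation d) : Type)} {z : (colimit (K ⋙ evaluation e) : Type)}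
      (hxy : ColimitRel f x y) (hyz : ColimitRel g y z) : ColimitRel (g ≫ f) x z

/-- The colimit of a diagram of relational presheaves. -/
noncomputable def colimitObj : RelPsh C where
  obj c := (colimit (K ⋙ evaluation c) : Type)
  rel f x y := ColimitRel K f x y
  refl x := by
    obtain ⟨j, y, rfl⟩ := toColimit_surjective x
    exact .of j _ _ _ ((K.obj j).refl y)
  trans := .trans

/-- The colimit cocone of a diagram of relational presheaves. -/
noncomputable def colimitCocone : Cocone K where
  pt := colimitObj K
  ι :=
    { app j :=
        { app _ x := toColimit K j x
          rel f x y h := .of j f x y h }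
      naturality j k u := by
        ext c x
        exact toColimit_map u x }

/-- The map out of the pointwise colimit induced by a cocone. -/
noncomputable def colimitDesc (s : Cocone K) (c : C) :
    (colimit (K ⋙ evaluation c) : Type) → s.pt.obj c :=
  colimit.desc (K ⋙ evaluation c) ((evaluation c).mapCocone s)

theorem colimitDesc_toColimit (s : Cocone K) {c : C} (j : J) (x : (K.obj j).obj c) :
    colimitDesc K s c (toColimit K j x) = (s.ι.app j).app c x :=
  colimit.ι_desc_apply (F := K ⋙ evaluation c) ((evaluation c).mapCocone s) j x

/-- The cocone `colimitCocone K` is a colimit. -/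
noncomputable def isColimitColimitCocone : IsColimit (colimitCocone K) where
  desc s :=
    { app := colimitDesc K s
      rel f x y h := by
        induction h with
        | of j f x y h =>
          rw [colimitDesc_toColimit, colimitDesc_toColimit]
          exact (s.ι.app j).rel f x y h
        | trans _ _ h₁ h₂ => exact s.pt.trans h₁ h₂ }
  fac s j := by
    ext c x
    exact colimitDesc_toColimit K s j x
  uniq s m hm := by
    ext c x
    obtain ⟨j, y, rfl⟩ := toColimit_surjective x
    refine Eq.trans ?_ (colimitDesc_toColimit K s j y).symm
    rw [← hm j]
    rfl

instance : HasColimits (RelPsh C) where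
  has_colimits_of_shape _ _ := { has_colimit K := ⟨_, isColimitColimitCocone K⟩ }

variable {K}

theorem ColimitRel.exists_rel [IsFiltered J] {c d : C} {f : d ⟶ c}
    {x : (colimit (K ⋙ evaluation c) : Type)} {y : (colimit (K ⋙ evaluation d) : Type)}
    (h : ColimitRel K f x y) :
    ∃ (j : J) (x' : (K.obj j).obj c) (y' : (K.obj j).obj d),
      toColimit K j x' = x ∧ toColimit K j y' = y ∧ (K.obj j).rel f x' y' := by
  induction h with
  | of j f x y h => exact ⟨j, x, y, rfl, rfl, h⟩
  | trans _ _ h₁ h₂ =>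
    obtain ⟨i, x, y, rfl, rfl, hxy⟩ := h₁
    obtain ⟨j, y', z, hy, rfl, hyz⟩ := h₂
    obtain ⟨k, u, v, e⟩ := toColimit_eq_iff.1 hy
    refine ⟨k, (K.map v).app _ x, (K.map u).app _ z, toColimit_map v x, toColimit_map u z, ?_⟩
    refine (K.obj k).trans ((K.map v).rel _ _ _ hxy) ?_
    rw [← e]
    exact (K.map u).rel _ _ _ hyz

theorem ColimitRel.exists_map_rel [IsFiltered J] {j : J} {c d : C} {f : d ⟶ c}
    {x : (K.obj j).obj c} {y : (K.obj j).obj d}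
    (h : ColimitRel K f (toColimit K j x) (toColimit K j y)) :
    ∃ (k : J) (u : j ⟶ k), (K.obj k).rel f ((K.map u).app c x) ((K.map u).app d y) := by
  obtain ⟨i, x', y', hx, hy, hxy⟩ := h.exists_rel
  obtain ⟨k, u, v, e⟩ := toColimit_eq_iff.1 hx
  obtain ⟨l, u', v', e'⟩ := toColimit_eq_iff.1 hy
  obtain ⟨m, p, q, r, h₁, h₂⟩ : ∃ (m : J) (p : k ⟶ m) (q : l ⟶ m) (r : j ⟶ m),
      u ≫ p = u' ≫ q ∧ v ≫ p = r ∧ v' ≫ q = r := by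
    obtain ⟨m, p, q, h⟩ := IsFiltered.span u u'
    obtain ⟨n, w, h'⟩ := IsFilteredOrEmpty.cocone_maps (v ≫ p) (v' ≫ q)
    refine ⟨n, p ≫ w, q ≫ w, v ≫ p ≫ w, ?_, rfl, ?_⟩
    · rw [← Category.assoc, h, Category.assoc]
    · simpa using h'.symm
  have key := (K.map (u ≫ p)).rel f x' y' hxy
  refine ⟨m, r, ?_⟩
  have ex : (K.map r).app c x = (K.map (u ≫ p)).app c x' := by
    rw [← h₂.1, K.map_comp, K.map_comp, comp_app, comp_app, e]
  have ey : (K.map r).app d y = (K.map (u ≫ p)).app d y' := by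
    rw [← h₂.2, h₁, K.map_comp, K.map_comp, comp_app, comp_app, e']
  rw [ex, ey]
  exact key

end Colimits

section Free

variable {I : Type} (c : I → C)

/-- The elements of the relational presheaf with a generator over `c i` for each `i`. -/
inductive FreeObj : C → Type
  | mk (i : I) : FreeObj (c i)

variable {c}

/-- The relations generated by a set of arrows between generators. -/
inductive FreeRel (R : Set (Σ i j : I, (c j ⟶ c i))) :
    ∀ {a b : C}, (b ⟶ a) → FreeObj c a → FreeObj c b → Prop
  | of (i j : I) (f : c j ⟶ c i) (h : ⟨i, j, f⟩ ∈ R) : FreeRel R f (.mk i) (.mk j)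
  | refl {a : C} (x : FreeObj c a) : FreeRel R (𝟙 a) x x
  | trans {a b d : C} {f : b ⟶ a} {g : d ⟶ b} {x : FreeObj c a} {y : FreeObj c b}
      {z : FreeObj c d} (hxy : FreeRel R f x y) (hyz : FreeRel R g y z) : FreeRel R (g ≫ f) x z

/-- The relational presheaf presented by generators and relations. -/
def free (R : Set (Σ i j : I, (c j ⟶ c i))) : RelPsh C where
  obj := FreeObj c
  rel f x y := FreeRel R f x y
  refl := .refl
  trans := .trans

variable {R : Set (Σ i j : I, (c j ⟶ c i))}

/-- The map out of the generators determined by a choice of values. -/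
def FreeObj.elim {F : C → Type} (x : ∀ i, F (c i)) : ∀ {a : C}, FreeObj c a → F a
  | _, .mk i => x i

/-- The morphism from `free R` determined by values of the generators satisfying `R`. -/
def freeLift {Q : RelPsh C} (x : ∀ i, Q.obj (c i))
    (h : ∀ i j f, ⟨i, j, f⟩ ∈ R → Q.rel f (x i) (x j)) : free R ⟶ Q where
  app _ y := y.elim x
  rel f y z hyz := by
    induction hyz with
    | of i j f hf => exact h i j f hf
    | refl y => exact Q.refl _
    | trans _ _ h₁ h₂ => exact Q.trans h₁ h₂

/-- The generators of `free R`. -/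
def gen (R : Set (Σ i j : I, (c j ⟶ c i))) (i : I) : (free R).obj (c i) := .mk i

theorem rel_gen {i j : I} {f : c j ⟶ c i} (h : ⟨i, j, f⟩ ∈ R) :
    (free R).rel f (gen R i) (gen R j) := .of i j f h

theorem free_hom_ext {Q : RelPsh C} {α β : free R ⟶ Q}
    (h : ∀ i, α.app (c i) (gen R i) = β.app (c i) (gen R i)) : α = β := by
  ext a x
  cases x with
  | mk i => exact h i

section Reindex

variable {I' : Type}

/-- The pullback of a set of arrows between generators along an equivalence. -/
def reindex (e : I' ≃ I) (R : Set (Σ i j : I, (c j ⟶ c i))) :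
    Set (Σ i j : I', ((c ∘ e) j ⟶ (c ∘ e) i)) :=
  {r | (⟨e r.1, e r.2.1, r.2.2⟩ : Σ i j : I, (c j ⟶ c i)) ∈ R}

theorem finite_reindex (e : I' ≃ I) (hR : R.Finite) : (reindex e R).Finite := by
  refine hR.preimage (f := fun r : (Σ i j : I', ((c ∘ e) j ⟶ (c ∘ e) i)) =>
    (⟨e r.1, e r.2.1, r.2.2⟩ : Σ i j : I, (c j ⟶ c i))) ?_
  rintro ⟨i, j, f⟩ _ ⟨i', j', f'⟩ _ h
  obtain ⟨hi, h⟩ := Sigma.mk.inj h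
  obtain rfl := e.injective hi
  obtain ⟨hj, h⟩ := Sigma.mk.inj (eq_of_heq h)
  obtain rfl := e.injective hj
  obtain rfl := eq_of_heq h
  rfl

/-- Reindexing generators along an equivalence does not change the presented object. -/
def freeReindex (e : I' ≃ I) (R : Set (Σ i j : I, (c j ⟶ c i))) :
    free (c := c ∘ e) (reindex e R) ≅ free R where
  hom := freeLift (fun i => gen R (e i)) (fun _ _ _ h => rel_gen (R := R) h)
  inv := freeLift (Q := free (c := c ∘ e) (reindex e R))
    (Equiv.piCongrLeft (fun i => FreeObj (c ∘ e) (c i)) e fun i => .mk i) (fun i j f h => by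
      obtain ⟨i, rfl⟩ := e.surjective i
      obtain ⟨j, rfl⟩ := e.surjective j
      rw [Equiv.piCongrLeft_apply_apply, Equiv.piCongrLeft_apply_apply]
      exact rel_gen (R := reindex e R) h)
  hom_inv_id := free_hom_ext fun i =>
    Equiv.piCongrLeft_apply_apply (fun i => FreeObj (c ∘ e) (c i)) e (fun i => .mk i) i
  inv_hom_id := free_hom_ext fun i => by
    obtain ⟨i, rfl⟩ := e.surjective i
    exact congrArg (FreeObj.elim (c := c ∘ e) (F := FreeObj c) fun i => .mk (e i))
      (Equiv.piCongrLeft_apply_apply (fun i => FreeObj (c ∘ e) (c i)) e (fun i => .mk i) i)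

end Reindex

theorem exists_hom_forall {J : Type} [SmallCategory J] [IsFiltered J] (j : J) {A : Type}
    [Finite A] (p : A → ∀ k, (j ⟶ k) → Prop)
    (mono : ∀ a {k l : J} (u : j ⟶ k) (v : k ⟶ l), p a k u → p a l (u ≫ v))
    (ex : ∀ a, ∃ (k : J) (u : j ⟶ k), p a k u) :
    ∃ (k : J) (u : j ⟶ k), ∀ a, p a k u := by
  classical
  cases nonempty_fintype A
  suffices h : ∀ s : Finset A, ∃ (k : J) (u : j ⟶ k), ∀ a ∈ s, p a k u by
    simpa using h Finset.univ
  intro s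
  induction s using Finset.induction with
  | empty => exact ⟨j, 𝟙 j, by simp⟩
  | insert a s _ ih =>
    obtain ⟨k, u, hu⟩ := ih
    obtain ⟨l, v, hv⟩ := ex a
    obtain ⟨m, g, g', h⟩ := IsFiltered.span u v
    refine ⟨m, u ≫ g, fun b hb => ?_⟩
    obtain rfl | hb := Finset.mem_insert.1 hb
    · rw [h]
      exact mono _ _ _ hv
    · exact mono _ _ _ (hu b hb)

theorem exists_toColimit_eq {J : Type} [SmallCategory J] [IsFiltered J] {K : J ⥤ RelPsh C}
    [Finite I] (x : ∀ i, (colimit (K ⋙ evaluation (c i)) : Type)) :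
    ∃ (j : J) (y : ∀ i, (K.obj j).obj (c i)), ∀ i, toColimit K j (y i) = x i := by
  classical
  cases nonempty_fintype I
  choose j y hy using fun i => toColimit_surjective (x i)
  obtain ⟨k, hk⟩ := IsFiltered.sup_objs_exists (Finset.univ.image j)
  have u (i : I) : j i ⟶ k :=
    (hk (Finset.mem_image_of_mem j (Finset.mem_univ i))).some
  exact ⟨k, fun i => (K.map (u i)).app _ (y i), fun i => (toColimit_map _ _).trans (hy i)⟩

theorem finitelyPresentable_free [Finite I] (hR : R.Finite) :
    FinitelyPresentable (RelPsh C) (free R) := by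
  refine ⟨⟨fun J _ _ => ⟨fun {K} => preservesColimit_of_preserves_colimit_cocone
    (isColimitColimitCocone K) (Types.FilteredColimit.isColimitOf' _ _ ?_ ?_)⟩⟩⟩
  · intro (φ : free R ⟶ colimitObj K)
    obtain ⟨j, x, hx⟩ := exists_toColimit_eq (K := K) fun i => φ.app (c i) (gen R i)
    have := hR.to_subtype
    obtain ⟨k, u, hu⟩ := exists_hom_forall j
      (fun (r : R) k u => (K.obj k).rel r.1.2.2 ((K.map u).app _ (x r.1.1))
        ((K.map u).app _ (x r.1.2.1)))
      (fun r k l u v h => by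
        rw [K.map_comp]
        exact (K.map v).rel _ _ _ h)
      (fun ⟨⟨i, i', f⟩, h⟩ => by
        apply ColimitRel.exists_map_rel
        rw [hx, hx]
        exact φ.rel f _ _ (rel_gen h))
    refine ⟨k, freeLift (fun i => (K.map u).app _ (x i)) fun i i' f h => hu ⟨_, h⟩, ?_⟩
    refine free_hom_ext fun i => ?_
    exact (hx i).symm.trans (toColimit_map u (x i)).symm
  · intro j (φ : free R ⟶ K.obj j) (ψ : free R ⟶ K.obj j) h
    replace h : φ ≫ (colimitCocone K).ι.app j = ψ ≫ (colimitCocone K).ι.app j := h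
    obtain ⟨k, u, hu⟩ := exists_hom_forall j
      (fun i k u => (K.map u).app (c i) (φ.app _ (gen R i)) = (K.map u).app (c i) (ψ.app _ (gen R i)))
      (fun i k l u v h => by rw [K.map_comp, comp_app, comp_app, h])
      (fun i => by
        have hi : toColimit K j (φ.app _ (gen R i)) = toColimit K j (ψ.app _ (gen R i)) :=
          congrArg (fun α => RelPshHom.app α (c i) (gen R i)) h
        obtain ⟨k, u, v, e⟩ := toColimit_eq_iff.1 hi
        obtain ⟨l, w, hw⟩ := IsFilteredOrEmpty.cocone_maps u v
        refine ⟨l, u ≫ w, ?_⟩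
        conv_rhs => rw [hw]
        rw [K.map_comp, K.map_comp, comp_app, comp_app, e])
    exact ⟨k, u, free_hom_ext hu⟩

end Free

section FiniteSubobjects

variable (P : RelPsh C)

/-- The arrows between pairs of elements of `P`. -/
abbrev Arrows : Type := Σ x y : (Σ c, P.obj c), (y.1 ⟶ x.1)

/-- The relations of `P` among the elements of `S` that belong to `T`. -/
def relationsIn (S : Finset (Σ c, P.obj c)) (T : Finset P.Arrows) :
    Set (Σ i j : S, (j.1.1 ⟶ i.1.1)) :=
  {r | ⟨r.1.1, r.2.1.1, r.2.2⟩ ∈ T ∧ P.rel r.2.2 r.1.1.2 r.2.1.1.2}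

theorem finite_relationsIn (S : Finset (Σ c, P.obj c)) (T : Finset P.Arrows) :
    (P.relationsIn S T).Finite := by
  refine Set.Finite.subset (Set.Finite.preimage (f := fun r : (Σ i j : S, (j.1.1 ⟶ i.1.1)) =>
    (⟨r.1.1, r.2.1.1, r.2.2⟩ : P.Arrows)) ?_ T.finite_toSet) (fun r hr => hr.1)
  rintro ⟨⟨i, hi⟩, ⟨j, hj⟩, f⟩ _ ⟨⟨i', hi'⟩, ⟨j', hj'⟩, f'⟩ _ h
  cases h
  rfl

/-- A finite set of elements of `P` together with a finite set of arrows between elements. -/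
structure FinitePart where
  elements : Finset (Σ c, P.obj c)
  arrows : Finset P.Arrows

variable {P}

instance : Preorder P.FinitePart where
  le p q := p.elements ⊆ q.elements ∧ p.arrows ⊆ q.arrows
  le_refl _ := ⟨subset_rfl, subset_rfl⟩
  le_trans _ _ _ h h' := ⟨h.1.trans h'.1, h.2.trans h'.2⟩

theorem FinitePart.elements_subset {p q : P.FinitePart} (h : p ≤ q) :
    p.elements ⊆ q.elements := h.1

theorem FinitePart.arrows_subset {p q : P.FinitePart} (h : p ≤ q) :
    p.arrows ⊆ q.arrows := h.2

open Classical in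
instance : IsDirectedOrder P.FinitePart where
  directed p q := ⟨⟨p.elements ∪ q.elements, p.arrows ∪ q.arrows⟩,
    ⟨Finset.subset_union_left, Finset.subset_union_left⟩,
    ⟨Finset.subset_union_right, Finset.subset_union_right⟩⟩

instance : Nonempty P.FinitePart := ⟨⟨∅, ∅⟩⟩

/-- The relational presheaf presented by a finite part of `P`. -/
abbrev FinitePart.presheaf (p : P.FinitePart) : RelPsh C :=
  free (P.relationsIn p.elements p.arrows)

/-- The generator of `p.presheaf` given by an element of `p`. -/
def FinitePart.gen (p : P.FinitePart) {c : C} (x : P.obj c) (hx : ⟨c, x⟩ ∈ p.elements) :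
    p.presheaf.obj c :=
  RelPsh.gen (P.relationsIn p.elements p.arrows) ⟨⟨c, x⟩, hx⟩

theorem FinitePart.rel_gen (p : P.FinitePart) {c d : C} {f : d ⟶ c} {x : P.obj c} {y : P.obj d}
    (hx : ⟨c, x⟩ ∈ p.elements) (hy : ⟨d, y⟩ ∈ p.elements)
    (hf : ⟨⟨c, x⟩, ⟨d, y⟩, f⟩ ∈ p.arrows) (h : P.rel f x y) :
    p.presheaf.rel f (p.gen x hx) (p.gen y hy) :=
  RelPsh.rel_gen (R := P.relationsIn p.elements p.arrows)
    (i := ⟨⟨c, x⟩, hx⟩) (j := ⟨⟨d, y⟩, hy⟩) ⟨hf, h⟩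

/-- The morphism between presented presheaves induced by an inclusion of finite parts. -/
def FinitePart.map {p q : P.FinitePart} (h : p ≤ q) : p.presheaf ⟶ q.presheaf :=
  freeLift (fun i => q.gen i.1.2 (elements_subset h i.2)) fun i j _ hf =>
    q.rel_gen (elements_subset h i.2) (elements_subset h j.2) (arrows_subset h hf.1) hf.2

variable (P)

/-- The diagram of the relational presheaves presented by the finite parts of `P`. -/
def finiteDiagram : P.FinitePart ⥤ RelPsh C where
  obj p := p.presheaf
  map u := FinitePart.map (leOfHom u)
  map_id _ := free_hom_ext fun _ => rfl
  map_comp _ _ := free_hom_ext fun _ => rfl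

/-- The canonical cocone over `finiteDiagram P` with point `P`. -/
def finiteCocone : Cocone P.finiteDiagram where
  pt := P
  ι :=
    { app p := (freeLift (fun i => i.1.2) (fun _ _ _ h => h.2) : p.presheaf ⟶ P)
      naturality p _ _ := free_hom_ext (R := P.relationsIn p.elements p.arrows) fun _ => rfl }

variable {P}

theorem app_finitePart_gen (s : Cocone P.finiteDiagram) {p q : P.FinitePart} (h : p ≤ q) {c : C}
    (x : P.obj c) (hx : ⟨c, x⟩ ∈ p.elements) :
    (s.ι.app p).app c (p.gen x hx) =
      (s.ι.app q).app c (q.gen x (FinitePart.elements_subset h hx)) :=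
  (congrArg (fun α => RelPshHom.app α c (p.gen x hx)) (s.w (homOfLE h))).symm

/-- The finite part consisting of a single element. -/
def FinitePart.single {c : C} (x : P.obj c) : P.FinitePart := ⟨{⟨c, x⟩}, ∅⟩

theorem FinitePart.mem_single {c : C} (x : P.obj c) : ⟨c, x⟩ ∈ (single x).elements :=
  Finset.mem_singleton_self _

theorem FinitePart.single_le {p : P.FinitePart} {c : C} {x : P.obj c}
    (hx : ⟨c, x⟩ ∈ p.elements) : single x ≤ p :=
  ⟨Finset.singleton_subset_iff.2 hx, Finset.empty_subset _⟩

variable (P)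

/-- The function out of `P` induced by a cocone over its finite parts. -/
def finiteDesc (s : Cocone P.finiteDiagram) (c : C) (x : P.obj c) : s.pt.obj c :=
  (s.ι.app (.single x)).app c (FinitePart.gen _ x (FinitePart.mem_single x))

theorem finiteDesc_eq (s : Cocone P.finiteDiagram) (p : P.FinitePart) {c : C} (x : P.obj c)
    (hx : ⟨c, x⟩ ∈ p.elements) : P.finiteDesc s c x = (s.ι.app p).app c (p.gen x hx) :=
  app_finitePart_gen s (FinitePart.single_le hx) x _

open Classical in
/-- Every relational presheaf is the colimit of its finite parts. -/
def isColimitFiniteCocone : IsColimit P.finiteCocone where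
  desc s :=
    { app := P.finiteDesc s
      rel {c d} f (x : P.obj c) (y : P.obj d) h := by
        let q : P.FinitePart := ⟨{⟨c, x⟩, ⟨d, y⟩}, {⟨⟨c, x⟩, ⟨d, y⟩, f⟩}⟩
        have hx : ⟨c, x⟩ ∈ q.elements := by simp [q]
        have hy : ⟨d, y⟩ ∈ q.elements := by simp [q]
        rw [finiteDesc_eq P s q x hx, finiteDesc_eq P s q y hy]
        exact (s.ι.app q).rel f _ _ (q.rel_gen hx hy (by simp [q]) h) }
  fac s p := free_hom_ext (R := P.relationsIn p.elements p.arrows) fun i =>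
    finiteDesc_eq P s p i.1.2 i.2
  uniq s m hm := by
    ext c (x : P.obj c)
    exact congrArg (fun α => RelPshHom.app α c (FinitePart.gen _ x (FinitePart.mem_single x)))
      (hm (.single x))

end FiniteSubobjects

end RelPsh

/-- For any small category `C`, the category `RelPsh C` is locally finitely
presentable: it is cocomplete and there is a small family of finitely presentable objects
such that every object is a filtered colimit of objects from this family. -/
theorem RelPsh.locallyFinitelyPresentable (C : Type) [SmallCategory C] :
    HasColimits (RelPsh C) ∧
    ∃ (ι : Type) (G : ι → RelPsh C),
      (∀ i, FinitelyPresentable (RelPsh C) (G i)) ∧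
      ∀ P : RelPsh C, ∃ (J : Type) (_ : SmallCategory J) (_ : IsFiltered J)
        (D : J ⥤ RelPsh C) (t : Cocone D),
        (∀ j : J, ∃ i : ι, Nonempty (D.obj j ≅ G i)) ∧
        Nonempty (IsColimit t) ∧ Nonempty (t.pt ≅ P) := by
  refine ⟨inferInstance, Σ (n : ℕ) (c : Fin n → C), {R : Set (Σ i j, (c j ⟶ c i)) // R.Finite},
    fun i => RelPsh.free i.2.2.1, fun i => RelPsh.finitelyPresentable_free i.2.2.2, fun P =>
    ⟨_, inferInstance, isFiltered_of_directed_le_nonempty _, P.finiteDiagram, P.finiteCocone, fun p => ?_,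
      ⟨P.isColimitFiniteCocone⟩, ⟨Iso.refl P⟩⟩⟩
  let e := (Fintype.equivFin p.elements).symm
  exact ⟨⟨_, _, RelPsh.reindex e (P.relationsIn p.elements p.arrows),
    RelPsh.finite_reindex e (P.finite_relationsIn p.elements p.arrows)⟩,
    ⟨(RelPsh.freeReindex e (P.relationsIn p.elements p.arrows)).symm⟩⟩
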